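/- Let γ ∈ (0,1] and suppose the two covariance updates satisfy, for every positive semidefinite Σ, both ρ₁(Σ) ⪰ γ ρ₂(Σ) + (1−γ)Q and ρ₂(Σ) ⪰ γ ρ₁(Σ) + (1−γ)Q. Then the information matrices H₁ := C₁ᵀR₁⁻¹C₁ and H₂ := C₂ᵀR₂⁻¹C₂ satisfy H₁ ⪯ γ⁻¹ H₂ and H₂ ⪯ γ⁻¹ H₁. -/

import Mathlib

open Matrix BigOperators

noncomputable section

/-- `R̃(Σ) = C (A Σ Aᵀ + Q) Cᵀ + R`. -/
def Rt {ny nz : ℕ} (A Q : Matrix (Fin ny) (Fin ny) ℝ)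
    (C : Matrix (Fin nz) (Fin ny) ℝ) (R : Matrix (Fin nz) (Fin nz) ℝ)
    (S : Matrix (Fin ny) (Fin ny) ℝ) : Matrix (Fin nz) (Fin nz) ℝ :=
  C * (A * S * Aᵀ + Q) * Cᵀ + R

/-- Optimal unknown-input filter gain `M(Σ)`. -/
def Mg {ny nz nd : ℕ} (A Q : Matrix (Fin ny) (Fin ny) ℝ) (G : Matrix (Fin ny) (Fin nd) ℝ)
    (C : Matrix (Fin nz) (Fin ny) ℝ) (R : Matrix (Fin nz) (Fin nz) ℝ)
    (S : Matrix (Fin ny) (Fin ny) ℝ) : Matrix (Fin nd) (Fin nz) ℝ :=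
  ((C * G)ᵀ * (Rt A Q C R S)⁻¹ * (C * G))⁻¹ * (C * G)ᵀ * (Rt A Q C R S)⁻¹

/-- Optimal state filter gain `K(Σ)`. -/
def Kg {ny nz : ℕ} (A Q : Matrix (Fin ny) (Fin ny) ℝ)
    (C : Matrix (Fin nz) (Fin ny) ℝ) (R : Matrix (Fin nz) (Fin nz) ℝ)
    (S : Matrix (Fin ny) (Fin ny) ℝ) : Matrix (Fin ny) (Fin nz) ℝ :=
  (A * S * Aᵀ + Q) * Cᵀ * (Rt A Q C R S)⁻¹

/-- Closed loop matrix `Ã(Σ)`. -/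
def Atil {ny nz nd : ℕ} (A Q : Matrix (Fin ny) (Fin ny) ℝ) (G : Matrix (Fin ny) (Fin nd) ℝ)
    (C : Matrix (Fin nz) (Fin ny) ℝ) (R : Matrix (Fin nz) (Fin nz) ℝ)
    (S : Matrix (Fin ny) (Fin ny) ℝ) : Matrix (Fin ny) (Fin ny) ℝ :=
  (1 - Kg A Q C R S * C) * (1 - G * Mg A Q G C R S * C) * A

/-- `F̃(Σ)`. -/
def Ftil {ny nz nd : ℕ} (A Q : Matrix (Fin ny) (Fin ny) ℝ) (G : Matrix (Fin ny) (Fin nd) ℝ)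
    (C : Matrix (Fin nz) (Fin ny) ℝ) (R : Matrix (Fin nz) (Fin nz) ℝ)
    (S : Matrix (Fin ny) (Fin ny) ℝ) : Matrix (Fin ny) (Fin ny) ℝ :=
  -((1 - Kg A Q C R S * C) * (1 - G * Mg A Q G C R S * C))

/-- `W̃(Σ)`. -/
def Wtil {ny nz nd : ℕ} (A Q : Matrix (Fin ny) (Fin ny) ℝ) (G : Matrix (Fin ny) (Fin nd) ℝ)
    (C : Matrix (Fin nz) (Fin ny) ℝ) (R : Matrix (Fin nz) (Fin nz) ℝ)
    (S : Matrix (Fin ny) (Fin ny) ℝ) : Matrix (Fin ny) (Fin nz) ℝ :=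
  G * Mg A Q G C R S - Kg A Q C R S * C * G * Mg A Q G C R S + Kg A Q C R S

/-- The state error covariance update map `ρ(Σ)`. -/
def rho {ny nz nd : ℕ} (A Q : Matrix (Fin ny) (Fin ny) ℝ) (G : Matrix (Fin ny) (Fin nd) ℝ)
    (C : Matrix (Fin nz) (Fin ny) ℝ) (R : Matrix (Fin nz) (Fin nz) ℝ)
    (S : Matrix (Fin ny) (Fin ny) ℝ) : Matrix (Fin ny) (Fin ny) ℝ :=
  Atil A Q G C R S * S * (Atil A Q G C R S)ᵀ
    + Ftil A Q G C R S * Q * (Ftil A Q G C R S)ᵀ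
    + Wtil A Q G C R S * R * (Wtil A Q G C R S)ᵀ

/-- The unknown-input error covariance update map `ρᵈ(Σ)`. -/
def rhod {ny nz nd : ℕ} (A Q : Matrix (Fin ny) (Fin ny) ℝ) (G : Matrix (Fin ny) (Fin nd) ℝ)
    (C : Matrix (Fin nz) (Fin ny) ℝ) (R : Matrix (Fin nz) (Fin nz) ℝ)
    (S : Matrix (Fin ny) (Fin ny) ℝ) : Matrix (Fin nd) (Fin nd) ℝ :=
  ((C * G)ᵀ * (Rt A Q C R S)⁻¹ * (C * G))⁻¹

lemma rho_struct {ny nz nd : ℕ} (A Q : Matrix (Fin ny) (Fin ny) ℝ) (G : Matrix (Fin ny) (Fin nd) ℝ)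
    (C : Matrix (Fin nz) (Fin ny) ℝ) (R : Matrix (Fin nz) (Fin nz) ℝ)
    (S : Matrix (Fin ny) (Fin ny) ℝ) :
    rho A Q G C R S = (1 - Wtil A Q G C R S * C) * (A * S * Aᵀ + Q) * (1 - Wtil A Q G C R S * C)ᵀ
      + Wtil A Q G C R S * R * (Wtil A Q G C R S)ᵀ := by
  have hL : (1 - Kg A Q C R S * C) * (1 - G * Mg A Q G C R S * C) = 1 - Wtil A Q G C R S * C := by
    unfold Wtil
    simp only [Matrix.sub_mul, Matrix.mul_sub, Matrix.add_mul, Matrix.mul_one, Matrix.one_mul,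
      Matrix.mul_assoc]
    abel
  unfold rho Atil Ftil
  rw [hL]
  simp only [Matrix.mul_add, Matrix.add_mul, Matrix.transpose_mul, Matrix.transpose_neg,
    Matrix.neg_mul, Matrix.mul_neg, neg_neg, Matrix.mul_assoc]

lemma gain_struct {ny nz nd : ℕ} (A Q : Matrix (Fin ny) (Fin ny) ℝ)
    (G : Matrix (Fin ny) (Fin nd) ℝ)
    (C : Matrix (Fin nz) (Fin ny) ℝ) (R : Matrix (Fin nz) (Fin nz) ℝ)
    (S : Matrix (Fin ny) (Fin ny) ℝ) (hR : R.PosDef) (hP : (A * S * Aᵀ + Q).PosDef)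
    (hF : (C * G).rank = nd) :
    rho A Q G C R S * Cᵀ = Wtil A Q G C R S * R := by
  have hRt : (Rt A Q C R S).PosDef := by
    unfold Rt
    have := hP.posSemidef.mul_mul_conjTranspose_same C
    rw [Matrix.conjTranspose_eq_transpose_of_trivial] at this
    exact Matrix.PosDef.posSemidef_add this hR
  have hinj : Function.Injective (C * G).mulVec := by
    have h1 : Module.finrank ℝ (LinearMap.range (C * G).mulVecLin) = nd := hF
    have h2 := LinearMap.finrank_range_add_finrank_ker (C * G).mulVecLin
    rw [h1, Module.finrank_fin_fun] at h2
    have h3 : Module.finrank ℝ (LinearMap.ker (C * G).mulVecLin) = 0 := by omega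
    have h4 := Submodule.finrank_eq_zero.mp h3
    exact LinearMap.ker_eq_bot.mp h4
  have hN : ((C * G)ᵀ * (Rt A Q C R S)⁻¹ * (C * G)).PosDef := by
    have := hRt.inv.conjTranspose_mul_mul_same hinj
    rwa [Matrix.conjTranspose_eq_transpose_of_trivial] at this
  have uRt : IsUnit (Rt A Q C R S).det := (Matrix.isUnit_iff_isUnit_det _).mp hRt.isUnit
  have uN := (Matrix.isUnit_iff_isUnit_det _).mp hN.isUnit
  set P := A * S * Aᵀ + Q with hPdef
  set N := (C * G)ᵀ * (Rt A Q C R S)⁻¹ * (C * G) with hNdef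
  have hMF : Mg A Q G C R S * (C * G) = 1 := by
    unfold Mg
    rw [← hNdef, Matrix.mul_assoc, Matrix.mul_assoc N⁻¹, ← Matrix.mul_assoc (C * G)ᵀ]
    rw [Matrix.mul_assoc, ← Matrix.mul_assoc (C * G)ᵀ, ← hNdef]
    exact Matrix.nonsing_inv_mul _ uN
  have hMR : Mg A Q G C R S * Rt A Q C R S = N⁻¹ * (C * G)ᵀ := by
    unfold Mg
    rw [← hNdef, Matrix.nonsing_inv_mul_cancel_right _ _ uRt]
  have hKR : Kg A Q C R S * Rt A Q C R S = P * Cᵀ := by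
    unfold Kg
    rw [Matrix.nonsing_inv_mul_cancel_right _ _ uRt]
  set Y := (G - Kg A Q C R S * (C * G)) * N⁻¹ with hY
  have hW : Wtil A Q G C R S
      = (G - Kg A Q C R S * (C * G)) * Mg A Q G C R S + Kg A Q C R S := by
    unfold Wtil
    simp only [Matrix.sub_mul, Matrix.mul_assoc]
  have hWR : Wtil A Q G C R S * Rt A Q C R S = P * Cᵀ + Y * (C * G)ᵀ := by
    rw [hW, Matrix.add_mul, Matrix.mul_assoc, hMR, hKR, hY, Matrix.mul_assoc, add_comm]
  have hWG : Wtil A Q G C R S * (C * G) = G := by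
    rw [hW, Matrix.add_mul, Matrix.mul_assoc, hMF, Matrix.mul_one]
    abel
  have hWr : Wtil A Q G C R S * R
      = (1 - Wtil A Q G C R S * C) * P * Cᵀ + Y * (C * G)ᵀ := by
    have h : Wtil A Q G C R S * (C * P * Cᵀ + R) = P * Cᵀ + Y * (C * G)ᵀ := hWR
    rw [Matrix.mul_add] at h
    rw [eq_sub_of_add_eq' h]
    simp only [Matrix.sub_mul, Matrix.one_mul, Matrix.mul_assoc]
    abel
  have hrho : rho A Q G C R S = (1 - Wtil A Q G C R S * C) * P + Y * Gᵀ := by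
    have hWGt : (C * G)ᵀ * (Wtil A Q G C R S)ᵀ = Gᵀ := by
      rw [← Matrix.transpose_mul, hWG]
    rw [rho_struct, ← hPdef, hWr, Matrix.add_mul _ (Y * _), Matrix.mul_assoc Y, hWGt,
      Matrix.transpose_sub, Matrix.transpose_one, Matrix.transpose_mul, Matrix.mul_sub,
      Matrix.mul_one, Matrix.mul_assoc _ Cᵀ]
    abel
  rw [hrho, hWr, Matrix.add_mul, Matrix.transpose_mul, Matrix.mul_assoc Y]

lemma young {n : ℕ} (R : Matrix (Fin n) (Fin n) ℝ) (hR : R.PosDef) (u v : Fin n → ℝ) :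
    2 * (u ⬝ᵥ v) ≤ u ⬝ᵥ (R *ᵥ u) + v ⬝ᵥ (R⁻¹ *ᵥ v) := by
  have uR : IsUnit R.det := (Matrix.isUnit_iff_isUnit_det _).mp hR.isUnit
  have h := hR.posSemidef.dotProduct_mulVec_nonneg (u - R⁻¹ *ᵥ v)
  have hs : Rᵀ = R := hR.isHermitian
  have h1 : R *ᵥ (R⁻¹ *ᵥ v) = v := by
    rw [Matrix.mulVec_mulVec, Matrix.mul_nonsing_inv _ uR, Matrix.one_mulVec]
  have h2 : (R⁻¹ *ᵥ v) ⬝ᵥ (R *ᵥ u) = u ⬝ᵥ v := by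
    rw [Matrix.dotProduct_mulVec, ← Matrix.mulVec_transpose, hs, h1, dotProduct_comm]
  simp only [star_trivial, Matrix.mulVec_sub, h1, sub_dotProduct, dotProduct_sub, h2] at h
  rw [dotProduct_comm (R⁻¹ *ᵥ v) v] at h
  linarith

/-- quadratic form of a congruence -/
lemma quad {m n : ℕ} (W : Matrix (Fin m) (Fin n) ℝ) (R : Matrix (Fin n) (Fin n) ℝ)
    (x : Fin m → ℝ) :
    x ⬝ᵥ ((W * R * Wᵀ) *ᵥ x) = (Wᵀ *ᵥ x) ⬝ᵥ (R *ᵥ (Wᵀ *ᵥ x)) := by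
  rw [Matrix.mul_assoc, ← Matrix.mulVec_mulVec, Matrix.dotProduct_mulVec,
    ← Matrix.mulVec_transpose, ← Matrix.mulVec_mulVec]

lemma quad_bound {ny nz nd : ℕ}
    (A Q : Matrix (Fin ny) (Fin ny) ℝ) (G : Matrix (Fin ny) (Fin nd) ℝ)
    (C1 C2 : Matrix (Fin nz) (Fin ny) ℝ) (R1 R2 : Matrix (Fin nz) (Fin nz) ℝ)
    (hQ : Q.PosDef) (hR1 : R1.PosDef) (hR2 : R2.PosDef)
    (hF1 : (C1 * G).rank = nd)
    (γ : ℝ) (hγ0 : 0 < γ) (hγ1 : γ ≤ 1) (S : Matrix (Fin ny) (Fin ny) ℝ)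
    (h12 : (rho A Q G C1 R1 S - (γ • rho A Q G C2 R2 S + (1 - γ) • Q)).PosSemidef)
    (P : Matrix (Fin ny) (Fin ny) ℝ) (hPdef : A * S * Aᵀ + Q = P) (hP : P.PosDef)
    (y : Fin ny → ℝ) :
    y ⬝ᵥ ((C1ᵀ * R1⁻¹ * C1) *ᵥ y) ≤
      γ⁻¹ * (y ⬝ᵥ ((C2ᵀ * R2⁻¹ * C2) *ᵥ y) + y ⬝ᵥ (P⁻¹ *ᵥ y)) := by
  have hH (C : Matrix (Fin nz) (Fin ny) ℝ) (R : Matrix (Fin nz) (Fin nz) ℝ) (z : Fin ny → ℝ) :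
      z ⬝ᵥ ((Cᵀ * R⁻¹ * C) *ᵥ z) = (C *ᵥ z) ⬝ᵥ (R⁻¹ *ᵥ (C *ᵥ z)) := by
    simpa using quad Cᵀ R⁻¹ z
  have hg := gain_struct A Q G C1 R1 S hR1 (hPdef ▸ hP) hF1
  have hs1 := rho_struct A Q G C1 R1 S
  have hs2 := rho_struct A Q G C2 R2 S
  rw [hPdef] at hs1 hs2
  have uR1 : IsUnit R1.det := (Matrix.isUnit_iff_isUnit_det _).mp hR1.isUnit
  set W1 := Wtil A Q G C1 R1 S
  set W2 := Wtil A Q G C2 R2 S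
  set ρ1 := rho A Q G C1 R1 S
  set ρ2 := rho A Q G C2 R2 S
  obtain ⟨x, hx⟩ : ∃ x, x = (C1ᵀ * R1⁻¹ * C1) *ᵥ y := ⟨_, rfl⟩
  -- domination
  have hdom := h12.dotProduct_mulVec_nonneg x
  have hq := hQ.posSemidef.dotProduct_mulVec_nonneg x
  simp only [star_trivial, Matrix.sub_mulVec, Matrix.add_mulVec, Matrix.smul_mulVec,
    dotProduct_sub, dotProduct_add, dotProduct_smul, smul_eq_mul] at hdom hq
  have hq' := mul_nonneg (sub_nonneg.mpr hγ1) hq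
  -- `a = (W₁ᵀ x) ⬝ (C₁ y)`
  have ha : x ⬝ᵥ (ρ1 *ᵥ x) = (W1ᵀ *ᵥ x) ⬝ᵥ (C1 *ᵥ y) := by
    have : ρ1 *ᵥ x = W1 *ᵥ (C1 *ᵥ y) := by
      rw [hx, Matrix.mulVec_mulVec, Matrix.mulVec_mulVec, ← Matrix.mul_assoc, ← Matrix.mul_assoc,
        hg, Matrix.mul_nonsing_inv_cancel_right _ _ uR1]
    rw [this, Matrix.dotProduct_mulVec, ← Matrix.mulVec_transpose]
  have ha2 : (W1ᵀ *ᵥ x) ⬝ᵥ (R1 *ᵥ (W1ᵀ *ᵥ x)) ≤ x ⬝ᵥ (ρ1 *ᵥ x) := by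
    rw [hs1, Matrix.add_mulVec, dotProduct_add, quad, quad]
    have := hP.posSemidef.dotProduct_mulVec_nonneg ((1 - W1 * C1)ᵀ *ᵥ x)
    rw [star_trivial] at this
    linarith
  have hy1 := young R1 hR1 (W1ᵀ *ᵥ x) (C1 *ᵥ y)
  rw [← ha, ← hH] at hy1
  -- second
  have hb : x ⬝ᵥ y = ((1 - W2 * C2)ᵀ *ᵥ x) ⬝ᵥ y + (W2ᵀ *ᵥ x) ⬝ᵥ (C2 *ᵥ y) := by
    rw [Matrix.mulVec_transpose, Matrix.mulVec_transpose, ← Matrix.dotProduct_mulVec,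
      ← Matrix.dotProduct_mulVec, Matrix.sub_mulVec, Matrix.one_mulVec, Matrix.mulVec_mulVec,
      dotProduct_sub]
    ring
  have hb2 : x ⬝ᵥ (ρ2 *ᵥ x) = ((1 - W2 * C2)ᵀ *ᵥ x) ⬝ᵥ (P *ᵥ ((1 - W2 * C2)ᵀ *ᵥ x))
      + (W2ᵀ *ᵥ x) ⬝ᵥ (R2 *ᵥ (W2ᵀ *ᵥ x)) := by
    rw [hs2, Matrix.add_mulVec, dotProduct_add, quad, quad]
  have hy2 := young P hP (γ • ((1 - W2 * C2)ᵀ *ᵥ x)) y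
  have hy3 := young R2 hR2 (γ • (W2ᵀ *ᵥ x)) (C2 *ᵥ y)
  rw [← hH] at hy3
  simp only [Matrix.mulVec_smul, smul_dotProduct, dotProduct_smul, smul_eq_mul] at hy2 hy3
  have hxy : y ⬝ᵥ ((C1ᵀ * R1⁻¹ * C1) *ᵥ y) = x ⬝ᵥ y := by rw [hx, dotProduct_comm]
  rw [hxy] at hy1 ⊢
  rw [← div_eq_inv_mul, le_div_iff₀ hγ0]
  generalize x ⬝ᵥ (ρ1 *ᵥ x) = a at *
  generalize x ⬝ᵥ (ρ2 *ᵥ x) = b at *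
  have h1 : γ * b ≤ x ⬝ᵥ y := by linarith
  have h2 : γ * (γ * b) ≤ γ * (x ⬝ᵥ y) := mul_le_mul_of_nonneg_left h1 hγ0.le
  have h3 : γ * (x ⬝ᵥ y) = γ * (((1 - W2 * C2)ᵀ *ᵥ x) ⬝ᵥ y)
      + γ * ((W2ᵀ *ᵥ x) ⬝ᵥ (C2 *ᵥ y)) := by rw [hb, mul_add]
  rw [hb2, mul_add, mul_add] at h2
  linarith

lemma one_side {ny nz nd : ℕ}
    (A Q : Matrix (Fin ny) (Fin ny) ℝ) (G : Matrix (Fin ny) (Fin nd) ℝ)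
    (C1 C2 : Matrix (Fin nz) (Fin ny) ℝ) (R1 R2 : Matrix (Fin nz) (Fin nz) ℝ)
    (hA : IsUnit A.det) (hQ : Q.PosDef) (hR1 : R1.PosDef) (hR2 : R2.PosDef)
    (hF1 : (C1 * G).rank = nd)
    (γ : ℝ) (hγ0 : 0 < γ) (hγ1 : γ ≤ 1)
    (h12 : ∀ S : Matrix (Fin ny) (Fin ny) ℝ, S.PosSemidef →
      (rho A Q G C1 R1 S - (γ • rho A Q G C2 R2 S + (1 - γ) • Q)).PosSemidef) :
    (γ⁻¹ • (C2ᵀ * R2⁻¹ * C2) - C1ᵀ * R1⁻¹ * C1).PosSemidef := by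
  have hsym (C : Matrix (Fin nz) (Fin ny) ℝ) (R : Matrix (Fin nz) (Fin nz) ℝ) (hR : R.PosDef) :
      (Cᵀ * R⁻¹ * C).IsHermitian := by
    have := (hR.inv.posSemidef.conjTranspose_mul_mul_same C).isHermitian
    rwa [Matrix.conjTranspose_eq_transpose_of_trivial] at this
  apply Matrix.PosSemidef.of_dotProduct_mulVec_nonneg
  · apply Matrix.IsHermitian.sub _ (hsym _ _ hR1)
    have h := hsym C2 R2 hR2
    unfold Matrix.IsHermitian at h ⊢
    rw [Matrix.conjTranspose_smul, h, star_trivial]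
  intro y
  simp only [star_trivial, Matrix.sub_mulVec, Matrix.smul_mulVec, dotProduct_sub,
    dotProduct_smul, smul_eq_mul, sub_nonneg]
  have key : ∀ n : ℕ, y ⬝ᵥ ((C1ᵀ * R1⁻¹ * C1) *ᵥ y) ≤
      γ⁻¹ * (y ⬝ᵥ ((C2ᵀ * R2⁻¹ * C2) *ᵥ y) + (1 / ((n : ℝ) + 1)) * (y ⬝ᵥ (Q⁻¹ *ᵥ y))) := by
    intro n
    have hn : (0 : ℝ) < (n : ℝ) + 1 := by positivity
    have hS : (A⁻¹ * ((n : ℝ) • Q) * (A⁻¹)ᵀ).PosSemidef := by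
      have := (hQ.posSemidef.smul (Nat.cast_nonneg (α := ℝ) n)).mul_mul_conjTranspose_same A⁻¹
      rwa [Matrix.conjTranspose_eq_transpose_of_trivial] at this
    have hP : A * (A⁻¹ * ((n : ℝ) • Q) * (A⁻¹)ᵀ) * Aᵀ + Q = ((n : ℝ) + 1) • Q := by
      have h1 : (A⁻¹)ᵀ * Aᵀ = 1 := by
        rw [← Matrix.transpose_mul, Matrix.mul_nonsing_inv _ hA, Matrix.transpose_one]
      rw [Matrix.mul_assoc A⁻¹, Matrix.mul_nonsing_inv_cancel_left _ _ hA, Matrix.mul_assoc, h1,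
        Matrix.mul_one, add_smul, one_smul]
    have h := quad_bound A Q G C1 C2 R1 R2 hQ hR1 hR2 hF1 γ hγ0 hγ1 _ (h12 _ hS) _ hP
      (hQ.smul hn) y
    have hinv : (((n : ℝ) + 1) • Q)⁻¹ = (1 / ((n : ℝ) + 1)) • Q⁻¹ := by
      apply Matrix.inv_eq_right_inv
      rw [Matrix.smul_mul, Matrix.mul_smul, smul_smul,
        Matrix.mul_nonsing_inv _ ((Matrix.isUnit_iff_isUnit_det _).mp hQ.isUnit),
        mul_one_div_cancel hn.ne', one_smul]
    rwa [hinv, Matrix.smul_mulVec, dotProduct_smul, smul_eq_mul] at h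
  have hlim := ((tendsto_one_div_add_atTop_nhds_zero_nat (𝕜 := ℝ)).mul_const
    (y ⬝ᵥ (Q⁻¹ *ᵥ y))).const_add (y ⬝ᵥ ((C2ᵀ * R2⁻¹ * C2) *ᵥ y)) |>.const_mul γ⁻¹
  have := ge_of_tendsto' hlim key
  simpa using this

/-- if the state covariance updates of two sensor models satisfy the
mutual `γ`-domination property `ρ₁(Σ) ⪰ γρ₂(Σ) + (1−γ)Q` and
`ρ₂(Σ) ⪰ γρ₁(Σ) + (1−γ)Q` for all PSD `Σ`, then the information matrices
`H_i = C_iᵀ R_i⁻¹ C_i` satisfy `H₁ ⪯ γ⁻¹H₂` and `H₂ ⪯ γ⁻¹H₁`. -/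
theorem info_matrix_continuity {ny nz nd : ℕ}
    (A Q : Matrix (Fin ny) (Fin ny) ℝ) (G : Matrix (Fin ny) (Fin nd) ℝ)
    (C1 C2 : Matrix (Fin nz) (Fin ny) ℝ) (R1 R2 : Matrix (Fin nz) (Fin nz) ℝ)
    (hA : IsUnit A.det) (hQ : Q.PosDef) (hR1 : R1.PosDef) (hR2 : R2.PosDef)
    (hF1 : (C1 * G).rank = nd) (hF2 : (C2 * G).rank = nd)
    (γ : ℝ) (hγ0 : 0 < γ) (hγ1 : γ ≤ 1)
    (h12 : ∀ S : Matrix (Fin ny) (Fin ny) ℝ, S.PosSemidef →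
      (rho A Q G C1 R1 S - (γ • rho A Q G C2 R2 S + (1 - γ) • Q)).PosSemidef)
    (h21 : ∀ S : Matrix (Fin ny) (Fin ny) ℝ, S.PosSemidef →
      (rho A Q G C2 R2 S - (γ • rho A Q G C1 R1 S + (1 - γ) • Q)).PosSemidef) :
    (γ⁻¹ • (C2ᵀ * R2⁻¹ * C2) - C1ᵀ * R1⁻¹ * C1).PosSemidef ∧
    (γ⁻¹ • (C1ᵀ * R1⁻¹ * C1) - C2ᵀ * R2⁻¹ * C2).PosSemidef := by
  exact ⟨one_side A Q G C1 C2 R1 R2 hA hQ hR1 hR2 hF1 γ hγ0 hγ1 h12,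
    one_side A Q G C2 C1 R2 R1 hA hQ hR2 hR1 hF2 γ hγ0 hγ1 h21⟩
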